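/- A proper k-subspace L ⊂ ker ε ⊂ U(b_+) is a left crossed submodule under the left adjoint action and the projected coaction if and only if L = L'_(l,I) := L_(l,I) ∩ ker ε (the span of the same monomials X^a H^b with the constant monomial (a,b) = (0,0) removed) for a (unique) pair (l,I) with l ∈ ℕ_0, I ⊂ ℕ finite, and (l,I) ≠ (0,∅). Moreover L'_(l,I) is finite-dimensional if and only if l = 0, and dim L'_(0,I) = (∑_{n∈I} n) − 1. -/

import Mathlib

open scoped TensorProduct

noncomputable section

namespace UBorel

variable (k : Type*) [Field k] [CharZero k]

/-- The underlying space of `U(b_+)`: the free `k`-module with basis indexed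
by `(n, m)`, the index `(n, m)` standing for the monomial `X^n H^m`. -/
abbrev UU := (ℕ × ℕ) →₀ k

/-- The basis monomial `X^n H^m`. -/
def umono (n m : ℕ) : UU k := Finsupp.single (n, m) 1

/-- The left adjoint action of `H`: `H ▷ X^n H^m = n X^n H^m`. -/
def adH : UU k →ₗ[k] UU k :=
  Finsupp.lsum k fun p =>
    LinearMap.toSpanSingleton k (UU k) ((p.1 : k) • umono k p.1 p.2)

/-- The left adjoint action of `X`:
`X ▷ X^n H^m = X^{n+1}(H^m - (H+1)^m) = -∑_{j<m} (m choose j) X^{n+1} H^j`. -/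
def adXU : UU k →ₗ[k] UU k :=
  Finsupp.lsum k fun p =>
    LinearMap.toSpanSingleton k (UU k)
      (∑ j ∈ Finset.range p.2, (-(p.2.choose j : k)) • umono k (p.1 + 1) j)

/-- The component of the coproduct
`Δ(X^n H^m) = ∑_{i≤n} ∑_{j≤m} (n choose i)(m choose j) X^i H^j ⊗ X^{n-i} H^{m-j}`
(viewed as a left coaction) along the basis element `X^a H^b` of the left
tensor factor. -/
def ucopComp (a b : ℕ) : UU k →ₗ[k] UU k :=
  Finsupp.lsum k fun p =>
    LinearMap.toSpanSingleton k (UU k)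
      (if a ≤ p.1 ∧ b ≤ p.2 then
        ((p.1.choose a * p.2.choose b : ℕ) : k) • umono k (p.1 - a) (p.2 - b)
      else 0)

/-- The counit: `ε(X^n H^m) = δ_{n,0} δ_{m,0}`. -/
def ucou : UU k →ₗ[k] k :=
  Finsupp.lsum k fun p => if p = (0, 0) then LinearMap.id else 0

/-- A left crossed `U(b_+)`-submodule of `U(b_+)`: stable under the left
adjoint action (of the generators `H` and `X`, hence of all of `U(b_+)`) and
under the left regular coaction `Δ`. -/
def IsCrossedU (L : Submodule k (UU k)) : Prop :=
  (∀ v ∈ L, adH k v ∈ L) ∧ (∀ v ∈ L, adXU k v ∈ L) ∧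
  (∀ a b : ℕ, ∀ v ∈ L, ucopComp k a b v ∈ L)

/-- The projection `x ↦ x - ε(x)·1` onto `ker ε`. -/
def uprojE : UU k →ₗ[k] UU k :=
  LinearMap.id - (Finsupp.lsingle (0, 0)).comp (ucou k)

/-- A left crossed submodule of `ker ε ⊂ U(b_+)` under the left adjoint action
and the projected left regular coaction. -/
def IsCrossedEU (L : Submodule k (UU k)) : Prop :=
  L ≤ LinearMap.ker (ucou k) ∧
  (∀ v ∈ L, adH k v ∈ L) ∧ (∀ v ∈ L, adXU k v ∈ L) ∧
  (∀ a b : ℕ, ∀ v ∈ L, (uprojE k).comp (ucopComp k a b) v ∈ L)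

/-- The set of monomials spanning `L_(l,I)`: all `X^a H^b` with `b < l`,
together with, for `0 ≤ j < |I|`, the `X^a H^{l+j}` with `a < n_{j+1}`, where
`n_{j+1}` is the `(j+1)`-st largest element of `I` (characterised by having
exactly `j` elements of `I` above it). -/
def Lmon (l : ℕ) (I : Finset ℕ) : Set (UU k) :=
  {v | ∃ a b : ℕ, v = umono k a b ∧
    (b < l ∨ (l ≤ b ∧ ∃ n ∈ I, (I.filter fun x => n < x).card = b - l ∧ a < n))}

/-- The crossed submodule `L_(l,I) ⊆ U(b_+)`. -/
def Lsub (l : ℕ) (I : Finset ℕ) : Submodule k (UU k) :=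
  Submodule.span k (Lmon k l I)

/-- The crossed submodule `L'_(l,I) = L_(l,I) ∩ ker ε ⊆ ker ε ⊂ U(b_+)`:
the span of the same monomials with the constant monomial `1` removed. -/
def Lsub' (l : ℕ) (I : Finset ℕ) : Submodule k (UU k) :=
  Submodule.span k (Lmon k l I \ {umono k 0 0})

end UBorel

namespace UBorel

/-! ### Coefficients of the structure maps -/

theorem adH_apply (k : Type*) [Field k] (v : UU k) (p : ℕ × ℕ) :
    adH k v p = (p.1 : k) * v p := by
  induction v using Finsupp.induction_linear with
  | zero => simp
  | add f g hf hg => simp [hf, hg, mul_add]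
  | single q c =>
    by_cases h : q = p
    · subst h
      simp [adH, umono, mul_comm]
    · simp [adH, umono, h]

theorem adXU_single (k : Type*) [Field k] (p : ℕ × ℕ) :
    adXU k (Finsupp.single p 1) =
      ∑ j ∈ Finset.range p.2, Finsupp.single (p.1 + 1, j) (-(p.2.choose j : k)) := by
  simp [adXU, umono]

theorem adXU_single_apply (k : Type*) [Field k] (p : ℕ × ℕ) {j : ℕ} (hj : j < p.2) :
    adXU k (Finsupp.single p 1) (p.1 + 1, j) = -(p.2.choose j : k) := by
  rw [adXU_single, Finsupp.finsetSum_apply, Finset.sum_eq_single j]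
  · simp
  · intro i _ hi
    simp [hi]
  · intro h
    exact absurd (Finset.mem_range.2 hj) h

theorem ucopComp_apply (k : Type*) [Field k] (a b : ℕ) (v : UU k) (p : ℕ × ℕ) :
    ucopComp k a b v p =
      ((p.1 + a).choose a * (p.2 + b).choose b : ℕ) * v (p.1 + a, p.2 + b) := by
  induction v using Finsupp.induction_linear with
  | zero => simp
  | add f g hf hg => rw [map_add, Finsupp.add_apply, hf, hg, Finsupp.add_apply, mul_add]
  | single q c =>
    obtain ⟨i, j⟩ := p
    obtain ⟨m, n⟩ := q
    simp only [ucopComp, umono, Finsupp.lsum_single, LinearMap.toSpanSingleton_apply]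
    by_cases h : (m, n) = (i + a, j + b)
    · obtain ⟨rfl, rfl⟩ := Prod.mk.inj h
      simp [mul_comm]
    · rw [Finsupp.single_eq_of_ne' h, mul_zero]
      split_ifs with hab
      · have : (m - a, n - b) ≠ (i, j) := by
          rintro e
          obtain ⟨rfl, rfl⟩ := Prod.mk.inj e
          exact h (by simp [hab.1, hab.2])
        simp [Finsupp.single_eq_of_ne' this]
      · simp

theorem ucou_apply (k : Type*) [Field k] (v : UU k) : ucou k v = v (0, 0) := by
  induction v using Finsupp.induction_linear with
  | zero => simp
  | add f g hf hg => simp [hf, hg]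
  | single q c =>
    by_cases h : q = (0, 0)
    · subst h
      simp [ucou]
    · simp [ucou, h]

theorem uprojE_apply (k : Type*) [Field k] (v : UU k) (p : ℕ × ℕ) :
    uprojE k v p = if p = (0, 0) then 0 else v p := by
  by_cases h : p = (0, 0)
  · subst h
    simp [uprojE, ucou_apply]
  · simp [uprojE, ucou_apply, h]

/-! ### Monomial submodules -/

theorem mem_supported_iff_coeff {ι k : Type*} [Field k] {S : Set ι} {v : ι →₀ k} :
    v ∈ Finsupp.supported k k S ↔ ∀ p, v p ≠ 0 → p ∈ S := by
  simp [Finsupp.mem_supported, Set.subset_def]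

theorem supported_le_of_single_mem {ι k : Type*} [Field k] {S : Set ι}
    {L : Submodule k (ι →₀ k)} (h : ∀ p ∈ S, Finsupp.single p 1 ∈ L) :
    Finsupp.supported k k S ≤ L := by
  rw [Finsupp.supported_eq_span_single, Submodule.span_le]
  rintro _ ⟨p, hp, rfl⟩
  exact h p hp

theorem eq_of_supported_eq {ι k : Type*} [Field k] {S T : Set ι}
    (h : Finsupp.supported k k S = Finsupp.supported k k T) : S = T := by
  ext p
  have key (U : Set ι) : p ∈ U ↔ Finsupp.single p (1 : k) ∈ Finsupp.supported k k U := by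
    refine ⟨Finsupp.single_mem_supported k 1, fun hU => ?_⟩
    exact mem_supported_iff_coeff.1 hU p (by simp)
  rw [key S, key T, h]

theorem ker_ucou (k : Type*) [Field k] :
    LinearMap.ker (ucou k) = Finsupp.supported k k {p | p ≠ (0, 0)} := by
  ext v
  rw [LinearMap.mem_ker, ucou_apply, mem_supported_iff_coeff]
  refine ⟨fun h p hp e => hp (e ▸ h), fun h => ?_⟩
  by_contra h0
  exact h _ h0 rfl

/-- The exponent pairs `(a, b)` of the monomials `X^a H^b` spanning `L_(l,I)`. -/
def shape (l : ℕ) (I : Finset ℕ) : Set (ℕ × ℕ) :=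
  {p | p.2 < l ∨ (l ≤ p.2 ∧ ∃ n ∈ I, (I.filter fun x => n < x).card = p.2 - l ∧ p.1 < n)}

theorem Lsub'_eq_supported (k : Type*) [Field k] (l : ℕ) (I : Finset ℕ) :
    Lsub' k l I = Finsupp.supported k k (shape l I \ {(0, 0)}) := by
  rw [Lsub', Finsupp.supported_eq_span_single]
  congr 1
  ext v
  constructor
  · rintro ⟨⟨a, b, rfl, h⟩, h0⟩
    exact ⟨(a, b), ⟨h, fun e => h0 (by
      obtain ⟨rfl, rfl⟩ := Prod.mk.inj e
      rfl)⟩, rfl⟩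
  · rintro ⟨⟨a, b⟩, ⟨h, h0⟩, rfl⟩
    refine ⟨⟨a, b, rfl, h⟩, fun e => h0 ?_⟩
    exact Finsupp.single_left_injective one_ne_zero e

/-- A staircase: a lower set of exponent pairs containing `(0, 0)`, in which a finite row is
strictly longer than the rows above it. -/
structure IsStaircase (S : Set (ℕ × ℕ)) : Prop where
  zero_mem : (0, 0) ∈ S
  isLowerSet : IsLowerSet S
  step : ∀ ⦃a b j : ℕ⦄, (a, b) ∈ S → j < b → (a + 1, j) ∈ S

theorem IsStaircase.isCrossedEU (k : Type*) [Field k] {S : Set (ℕ × ℕ)} (hS : IsStaircase S) :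
    IsCrossedEU k (Finsupp.supported k k (S \ {(0, 0)})) := by
  refine ⟨?_, ?_, ?_, ?_⟩
  · rw [ker_ucou]
    exact Finsupp.supported_mono fun p hp => hp.2
  · intro v hv
    rw [mem_supported_iff_coeff] at hv ⊢
    intro p hp
    rw [adH_apply] at hp
    exact hv p (right_ne_zero_of_mul hp)
  · suffices h : Finsupp.supported k k (S \ {(0, 0)}) ≤
        (Finsupp.supported k k (S \ {(0, 0)})).comap (adXU k) from fun v hv => h hv
    refine supported_le_of_single_mem fun p hp => ?_
    rw [Submodule.mem_comap, adXU_single]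
    refine Submodule.sum_mem _ fun j hj => Finsupp.single_mem_supported k _ ?_
    exact ⟨hS.step hp.1 (Finset.mem_range.1 hj), by simp⟩
  · intro a b v hv
    rw [mem_supported_iff_coeff] at hv ⊢
    intro p hp
    rw [LinearMap.comp_apply, uprojE_apply] at hp
    split_ifs at hp with h0
    · exact absurd rfl hp
    · rw [ucopComp_apply] at hp
      refine ⟨hS.isLowerSet ?_ (hv _ (right_ne_zero_of_mul hp)).1, h0⟩
      exact Prod.mk_le_mk.2 ⟨Nat.le_add_right _ _, Nat.le_add_right _ _⟩

/-! ### Crossed submodules are monomial -/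

theorem filter_fst_mem_of_adH_stable {k : Type*} [Field k] [CharZero k] {L : Submodule k (UU k)}
    (hL : ∀ v ∈ L, adH k v ∈ L) (T : Finset ℕ) :
    ∀ v ∈ L, (∀ p, v p ≠ 0 → p.1 ∈ T) → ∀ n, v.filter (fun p => p.1 = n) ∈ L := by
  induction T using Finset.induction_on with
  | empty =>
    intro v _ hT n
    have : v = 0 := by
      ext p
      by_contra h
      exact absurd (hT p h) (Finset.notMem_empty _)
    rw [this, Finsupp.filter_zero]
    exact L.zero_mem
  | insert t T ht ih =>
    intro v hv hT
    have hne : ∀ n, n ≠ t → v.filter (fun p => p.1 = n) ∈ L := by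
      intro n hn
      have hw := ih (adH k v - (t : k) • v) (L.sub_mem (hL v hv) (L.smul_mem _ hv)) ?_ n
      · have hnt : (n : k) - t ≠ 0 := sub_ne_zero.2 (by exact_mod_cast hn)
        have e : (adH k v - (t : k) • v).filter (fun p => p.1 = n) =
            ((n : k) - t) • v.filter (fun p => p.1 = n) := by
          ext p
          by_cases hp : p.1 = n
          · simp [hp, adH_apply, sub_mul]
          · simp [hp]
        rw [e] at hw
        exact (L.smul_mem_iff hnt).1 hw
      · intro p hp
        rw [Finsupp.sub_apply, adH_apply, Finsupp.smul_apply, smul_eq_mul, ← sub_mul] at hp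
        have hpt : p.1 ≠ t := by
          rintro rfl
          simp at hp
        exact Finset.mem_of_mem_insert_of_ne (hT p (right_ne_zero_of_mul hp)) hpt
    intro n
    by_cases hn : n = t
    · subst hn
      have e : v.filter (fun p => p.1 = n) =
          v - ∑ m ∈ T, v.filter (fun p => p.1 = m) := by
        ext p
        rw [Finsupp.sub_apply, Finsupp.finsetSum_apply]
        simp only [Finsupp.filter_apply, Finset.sum_ite_eq]
        by_cases hp : p.1 = n
        · simp [hp, ht]
        · by_cases h0 : v p = 0
          · simp [h0]
          · simp [hp, Finset.mem_of_mem_insert_of_ne (hT p h0) hp]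
      rw [e]
      refine L.sub_mem hv (L.sum_mem fun m hm => hne m ?_)
      rintro rfl
      exact ht hm
    · exact hne n hn

theorem single_mem_of_top_degree {k : Type*} [Field k] [CharZero k] {L : Submodule k (UU k)}
    (hL : IsCrossedEU k L) {v : UU k} (hv : v ∈ L) {n d : ℕ} (hd : v (n, d) ≠ 0)
    (hsupp : ∀ p, v p ≠ 0 → p.1 = n ∧ p.2 ≤ d) (j : ℕ) (hj : j ≤ d) (h0 : (n, j) ≠ (0, 0)) :
    Finsupp.single (n, j) 1 ∈ L := by
  induction j using Nat.strong_induction_on with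
  | _ j ih =>
    obtain ⟨e, rfl⟩ := Nat.exists_eq_add_of_le hj
    set w := (uprojE k).comp (ucopComp k 0 e) v with hw
    have hwL : w ∈ L := hL.2.2.2 0 e v hv
    have hwp : ∀ p, w p = if p = (0, 0) then 0 else
        ((p.2 + e).choose e : k) * v (p.1, p.2 + e) := by
      intro p
      rw [hw, LinearMap.comp_apply, uprojE_apply, ucopComp_apply]
      simp
    have hwj : w (n, j) ≠ 0 := by
      rw [hwp, if_neg h0]
      exact mul_ne_zero (by exact_mod_cast (Nat.choose_pos (Nat.le_add_left _ _)).ne') hd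
    have herase : w.erase (n, j) ∈ L := by
      have hle : Finsupp.supported k k {p | p.1 = n ∧ p.2 < j ∧ p ≠ (0, 0)} ≤ L := by
        refine supported_le_of_single_mem ?_
        rintro ⟨_, i⟩ ⟨rfl, hi, hi0⟩
        exact ih i hi (by dsimp only at hi; omega) hi0
      refine hle (mem_supported_iff_coeff.2 fun p hp => ?_)
      have hpj : p ≠ (n, j) := by
        rintro rfl
        simp at hp
      rw [Finsupp.erase_ne hpj, hwp] at hp
      split_ifs at hp with hp0
      · exact absurd rfl hp
      · obtain ⟨h1, h2⟩ := hsupp _ (right_ne_zero_of_mul hp)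
        dsimp only at h1 h2
        refine ⟨h1, lt_of_le_of_ne (by omega) fun h => hpj (Prod.ext h1 h), hp0⟩
    have hs : Finsupp.single (n, j) (w (n, j)) ∈ L := by
      have := L.sub_mem hwL herase
      rwa [sub_eq_of_eq_add (Finsupp.single_add_erase (n, j) w).symm] at this
    rw [← mul_one (w (n, j)), ← smul_eq_mul, ← Finsupp.smul_single] at hs
    exact (L.smul_mem_iff hwj).1 hs

theorem single_mem_of_coeff_ne_zero {k : Type*} [Field k] [CharZero k] {L : Submodule k (UU k)}
    (hL : IsCrossedEU k L) {v : UU k} (hv : v ∈ L) {p : ℕ × ℕ} (hp : v p ≠ 0) :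
    Finsupp.single p 1 ∈ L := by
  have hp0 : p ≠ (0, 0) := by
    rintro rfl
    exact hp (by rw [← ucou_apply]; exact hL.1 hv)
  obtain ⟨n, j⟩ := p
  set w := v.filter (fun q => q.1 = n) with hw
  have hwL : w ∈ L := filter_fst_mem_of_adH_stable hL.2.1 (v.support.image Prod.fst) v hv
    (fun q hq => Finset.mem_image_of_mem _ (Finsupp.mem_support_iff.2 hq)) n
  have hpw : (n, j) ∈ w.support := by simpa [hw, Finsupp.filter_apply] using hp
  obtain ⟨⟨m, d⟩, hq, hmax⟩ := w.support.exists_max_image Prod.snd ⟨_, hpw⟩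
  have hfst : ∀ q, w q ≠ 0 → q.1 = n := by
    intro q hq
    by_contra h
    exact hq (Finsupp.filter_apply_neg _ _ h)
  obtain rfl : m = n := hfst _ (Finsupp.mem_support_iff.1 hq)
  exact single_mem_of_top_degree hL hwL (Finsupp.mem_support_iff.1 hq)
    (fun q hq => ⟨hfst q hq, hmax q (Finsupp.mem_support_iff.2 hq)⟩) j (hmax _ hpw) hp0

theorem IsCrossedEU.exists_staircase {k : Type*} [Field k] [CharZero k] {L : Submodule k (UU k)}
    (hL : IsCrossedEU k L) :
    ∃ S, IsStaircase S ∧ L = Finsupp.supported k k (S \ {(0, 0)}) := by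
  have h0 : Finsupp.single (0, 0) (1 : k) ∉ L := by
    intro h
    have := hL.1 h
    simp [LinearMap.mem_ker, ucou_apply] at this
  refine ⟨{p | p = (0, 0) ∨ Finsupp.single p (1 : k) ∈ L}, ⟨Or.inl rfl, ?_, ?_⟩, ?_⟩
  · rintro p q hqp (rfl | hp)
    · exact Or.inl (Prod.ext (Nat.le_zero.1 hqp.1) (Nat.le_zero.1 hqp.2))
    · by_cases hq : q = (0, 0)
      · exact Or.inl hq
      · refine Or.inr (single_mem_of_coeff_ne_zero hL
          (hL.2.2.2 (p.1 - q.1) (p.2 - q.2) _ hp) ?_)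
        have e : (q.1 + (p.1 - q.1), q.2 + (p.2 - q.2)) = p :=
          Prod.ext (Nat.add_sub_of_le hqp.1) (Nat.add_sub_of_le hqp.2)
        rw [LinearMap.comp_apply, uprojE_apply, if_neg hq, ucopComp_apply, e,
          Finsupp.single_eq_same, mul_one, Nat.cast_ne_zero]
        exact (Nat.mul_pos (Nat.choose_pos (Nat.le_add_left _ _))
          (Nat.choose_pos (Nat.le_add_left _ _))).ne'
  · rintro a b j (h | h) hj
    · simp only [Prod.mk.injEq] at h
      omega
    · refine Or.inr (single_mem_of_coeff_ne_zero hL (hL.2.2.1 _ h) ?_)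
      rw [adXU_single_apply k (a, b) hj, neg_ne_zero, Nat.cast_ne_zero]
      exact (Nat.choose_pos hj.le).ne'
  · refine le_antisymm (fun v hv => mem_supported_iff_coeff.2 fun p hp => ?_) ?_
    · have hpL := single_mem_of_coeff_ne_zero hL hv hp
      exact ⟨Or.inr hpL, fun e => h0 (e ▸ hpL)⟩
    · exact supported_le_of_single_mem fun p hp => hp.1.resolve_left hp.2

/-! ### Combinatorics of the shapes -/

/-- The number of elements of `I` above `n`. -/
def rankAbove (I : Finset ℕ) (n : ℕ) : ℕ := (I.filter fun x => n < x).card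

theorem rankAbove_lt_rankAbove {I : Finset ℕ} {m n : ℕ} (hn : n ∈ I) (h : m < n) :
    rankAbove I n < rankAbove I m := by
  refine Finset.card_lt_card (Finset.ssubset_iff_of_subset ?_ |>.2 ⟨n, ?_, ?_⟩)
  · intro x hx
    rw [Finset.mem_filter] at hx ⊢
    exact ⟨hx.1, h.trans hx.2⟩
  · simp [hn, h]
  · simp

theorem rankAbove_injOn (I : Finset ℕ) : Set.InjOn (rankAbove I) I := by
  intro m hm n hn h
  rcases lt_trichotomy m n with hlt | rfl | hlt
  · exact absurd h (rankAbove_lt_rankAbove hn hlt).ne'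
  · rfl
  · exact absurd h (rankAbove_lt_rankAbove hm hlt).ne

theorem rankAbove_lt_card {I : Finset ℕ} {n : ℕ} (hn : n ∈ I) : rankAbove I n < I.card :=
  Finset.card_lt_card (Finset.filter_ssubset.2 ⟨n, hn, lt_irrefl n⟩)

theorem exists_rankAbove_eq {I : Finset ℕ} {r : ℕ} (hr : r < I.card) :
    ∃ n ∈ I, rankAbove I n = r :=
  Finset.surjOn_of_injOn_of_card_le (s := I) (t := Finset.range I.card) (rankAbove I)
    (fun _ hn => Finset.mem_coe.2 (Finset.mem_range.2 (rankAbove_lt_card hn)))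
    (rankAbove_injOn I) (by simp) (Finset.mem_coe.2 (Finset.mem_range.2 hr))

theorem mem_shape {l : ℕ} {I : Finset ℕ} {a b : ℕ} :
    (a, b) ∈ shape l I ↔ b < l ∨ (l ≤ b ∧ ∃ n ∈ I, rankAbove I n = b - l ∧ a < n) :=
  Iff.rfl

theorem shape_isStaircase {l : ℕ} {I : Finset ℕ} (h0 : 0 ∉ I) (h : (l, I) ≠ (0, ∅)) :
    IsStaircase (shape l I) := by
  have step : ∀ ⦃a b j : ℕ⦄, (a, b) ∈ shape l I → j < b → (a + 1, j) ∈ shape l I := by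
    intro a b j hab hj
    rw [mem_shape] at hab ⊢
    rcases hab with hb | ⟨hb, n, hn, hr, ha⟩
    · exact Or.inl (hj.trans hb)
    · rcases lt_or_ge j l with hjl | hjl
      · exact Or.inl hjl
      · have hrank := rankAbove_lt_card hn
        obtain ⟨m, hm, hmr⟩ := exists_rankAbove_eq (I := I) (r := j - l) (by omega)
        have hnm : n < m := by
          by_contra hmn
          rcases (not_lt.1 hmn).eq_or_lt with rfl | hlt
          · omega
          · have := rankAbove_lt_rankAbove hn hlt
            omega
        exact Or.inr ⟨hjl, m, hm, hmr, by omega⟩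
  have left : ∀ ⦃a a' b : ℕ⦄, (a, b) ∈ shape l I → a' ≤ a → (a', b) ∈ shape l I := by
    rintro a a' b (hb | ⟨hb, n, hn, hr, ha⟩) h
    · exact Or.inl hb
    · exact Or.inr ⟨hb, n, hn, hr, h.trans_lt ha⟩
  refine ⟨?_, ?_, step⟩
  · rw [mem_shape]
    rcases Nat.eq_zero_or_pos l with rfl | hl
    · have hI : I.Nonempty := by
        rw [Finset.nonempty_iff_ne_empty]
        rintro rfl
        exact h rfl
      obtain ⟨n, hn, hr⟩ := exists_rankAbove_eq hI.card_pos
      exact Or.inr ⟨le_rfl, n, hn, hr, Nat.pos_of_ne_zero fun e => h0 (e ▸ hn)⟩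
    · exact Or.inl hl
  · rintro ⟨a, b⟩ ⟨a', b'⟩ hle hab
    obtain ⟨ha, hb⟩ := Prod.mk_le_mk.1 hle
    rcases hb.eq_or_lt with rfl | hlt
    · exact left hab ha
    · exact left (step hab hlt) (by omega)

theorem row_of_le {l b : ℕ} {I : Finset ℕ} (hb : l ≤ b) :
    (∀ a, (a, b) ∉ shape l I) ∨
      ∃ n ∈ I, rankAbove I n = b - l ∧ ∀ a, (a, b) ∈ shape l I ↔ a < n := by
  by_cases h : b - l < I.card
  · obtain ⟨n, hn, hr⟩ := exists_rankAbove_eq h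
    refine Or.inr ⟨n, hn, hr, fun a => ?_⟩
    rw [mem_shape]
    constructor
    · rintro (h' | ⟨_, m, hm, hmr, ha⟩)
      · omega
      · rwa [rankAbove_injOn I hn hm (hr.trans hmr.symm)]
    · exact fun ha => Or.inr ⟨hb, n, hn, hr, ha⟩
  · refine Or.inl fun a => ?_
    rintro (h' | ⟨_, m, hm, hmr, -⟩)
    · dsimp only at h'
      omega
    · have := rankAbove_lt_card hm
      exact h (hmr ▸ this)

theorem lt_iff_row_eq_univ {l b : ℕ} {I : Finset ℕ} : b < l ↔ ∀ a, (a, b) ∈ shape l I := by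
  refine ⟨fun h a => Or.inl h, fun h => ?_⟩
  by_contra hb
  rcases row_of_le (I := I) (not_lt.1 hb) with h' | ⟨n, -, -, h'⟩
  · exact h' 0 (h 0)
  · exact lt_irrefl n ((h' n).1 (h n))

theorem mem_iff_row {l n : ℕ} {I : Finset ℕ} (h0 : 0 ∉ I) :
    n ∈ I ↔ 0 < n ∧ ∃ b, ∀ a, (a, b) ∈ shape l I ↔ a < n := by
  constructor
  · intro hn
    refine ⟨Nat.pos_of_ne_zero fun e => h0 (e ▸ hn), l + rankAbove I n, ?_⟩
    rcases row_of_le (I := I) (Nat.le_add_right l (rankAbove I n)) with h | ⟨m, hm, hr, h⟩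
    · refine absurd (Or.inr ⟨Nat.le_add_right _ _, n, hn, ?_, ?_⟩) (h 0)
      · rw [Nat.add_sub_cancel_left]
        rfl
      · exact Nat.pos_of_ne_zero fun e => h0 (e ▸ hn)
    · rw [Nat.add_sub_cancel_left] at hr
      obtain rfl := rankAbove_injOn I hm hn hr
      exact h
  · rintro ⟨hn, b, hb⟩
    have hlb : l ≤ b := by
      by_contra h
      exact lt_irrefl n ((hb n).1 (Or.inl (not_le.1 h)))
    rcases row_of_le (I := I) hlb with h | ⟨m, hm, -, h⟩
    · exact absurd ((hb 0).2 hn) (h 0)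
    · have : n = m := by
        have h1 := (hb n).symm.trans (h n)
        have h2 := (hb m).symm.trans (h m)
        omega
      rwa [this]

theorem shape_injective {l l' : ℕ} {I I' : Finset ℕ} (h0 : 0 ∉ I) (h0' : 0 ∉ I')
    (h : shape l I = shape l' I') : l = l' ∧ I = I' := by
  constructor
  · have key : ∀ b, b < l ↔ b < l' := fun b => by
      rw [lt_iff_row_eq_univ (I := I), lt_iff_row_eq_univ (I := I'), h]
    have h1 := key l
    have h2 := key l'
    omega
  · ext n
    rw [mem_iff_row (l := l) h0, mem_iff_row (l := l') h0', h]

theorem IsStaircase.exists_zero_fst_notMem {S : Set (ℕ × ℕ)} (hS : IsStaircase S) (hne : S ≠ Set.univ) :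
    ∃ b, (0, b) ∉ S := by
  by_contra! h
  refine hne (Set.eq_univ_of_forall ?_)
  have : ∀ a b, (a, b) ∈ S := by
    intro a
    induction a with
    | zero => exact h
    | succ a ih => exact fun b => hS.step (ih (b + 1)) b.lt_succ_self
  exact fun p => this p.1 p.2

theorem IsStaircase.exists_eq_shape {S : Set (ℕ × ℕ)} (hS : IsStaircase S)
    (hne : S ≠ Set.univ) :
    ∃ l I, 0 ∉ I ∧ (l, I) ≠ (0, (∅ : Finset ℕ)) ∧ S = shape l I := by
  classical
  have hfin := hS.exists_zero_fst_notMem hne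
  have hex : ∃ b a, (a, b) ∉ S := hfin.imp fun b hb => ⟨0, hb⟩
  set N := Nat.find hfin with hN
  set l := Nat.find hex with hl
  have hlow : ∀ {a b a' b' : ℕ}, (a, b) ∈ S → a' ≤ a → b' ≤ b → (a', b') ∈ S :=
    fun h ha hb => hS.isLowerSet (Prod.mk_le_mk.2 ⟨ha, hb⟩) h
  have hNS : ∀ b, (0, b) ∈ S ↔ b < N := by
    intro b
    refine ⟨fun h => ?_, fun h => not_not.1 (Nat.find_min hfin h)⟩
    by_contra hb
    exact Nat.find_spec hfin (hlow h le_rfl (not_lt.1 hb))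
  have hlS : ∀ b, b < l → ∀ a, (a, b) ∈ S := by
    intro b hb
    simpa using Nat.find_min hex hb
  have hrow : ∀ b, l ≤ b → ∃ n, ∀ a, (a, b) ∈ S ↔ a < n := by
    intro b hb
    obtain ⟨a₀, ha₀⟩ := Nat.find_spec hex
    have hb' : ∃ a, (a, b) ∉ S := ⟨a₀, fun h => ha₀ (hlow h le_rfl hb)⟩
    refine ⟨Nat.find hb', fun a => ⟨fun h => ?_, fun h => not_not.1 (Nat.find_min hb' h)⟩⟩
    by_contra ha
    exact Nat.find_spec hb' (hlow h (not_lt.1 ha) le_rfl)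
  choose! f hf using hrow
  have hpos : ∀ b, l ≤ b → (0 < f b ↔ b < N) := fun b hb => by rw [← hf b hb, hNS]
  have hanti : ∀ b b', l ≤ b → b < b' → b' < N → f b' < f b := by
    intro b b' hb hbb' hN'
    have h1 : 0 < f b' := (hpos b' (hb.trans hbb'.le)).2 hN'
    have h2 : (f b' - 1, b') ∈ S := (hf b' (hb.trans hbb'.le) _).2 (by omega)
    have h3 := (hf b hb _).1 (hS.step h2 hbb')
    omega
  have hanti_iff : ∀ b b', l ≤ b → l ≤ b' → b < N → b' < N → (f b < f b' ↔ b' < b) := by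
    intro b b' hb hb' hbN hbN'
    refine ⟨fun h => ?_, fun h => hanti b' b hb' h hbN⟩
    by_contra hle
    rcases (not_lt.1 hle).eq_or_lt with rfl | hlt
    · exact lt_irrefl _ h
    · exact lt_asymm h (hanti b b' hb hlt hbN')
  set I := (Finset.Ico l N).image f with hI
  have hrank : ∀ b, l ≤ b → b < N → rankAbove I (f b) = b - l := by
    intro b hb hbN
    have e : I.filter (fun x => f b < x) = (Finset.Ico l b).image f := by
      ext x
      simp only [hI, Finset.mem_filter, Finset.mem_image, Finset.mem_Ico]
      constructor
      · rintro ⟨⟨c, hc, rfl⟩, hlt⟩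
        exact ⟨c, ⟨hc.1, (hanti_iff b c hb hc.1 hbN hc.2).1 hlt⟩, rfl⟩
      · rintro ⟨c, hc, rfl⟩
        exact ⟨⟨c, ⟨hc.1, hc.2.trans hbN⟩, rfl⟩, hanti c b hc.1 hc.2 hbN⟩
    rw [rankAbove, e, Finset.card_image_of_injOn, Nat.card_Ico]
    intro c hc d hd hcd
    simp only [Finset.coe_Ico, Set.mem_Ico] at hc hd
    rcases lt_trichotomy c d with h | h | h
    · exact absurd hcd (hanti c d hc.1 h (hd.2.trans hbN)).ne'
    · exact h
    · exact absurd hcd (hanti d c hd.1 h (hc.2.trans hbN)).ne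
  refine ⟨l, I, ?_, ?_, ?_⟩
  · intro h
    obtain ⟨b, hb, hb0⟩ := Finset.mem_image.1 h
    rw [Finset.mem_Ico] at hb
    exact ((hpos b hb.1).2 hb.2).ne' hb0
  · intro h
    obtain ⟨h1, h2⟩ := Prod.mk.inj h
    have hN0 : 0 < N := (hNS 0).1 hS.zero_mem
    rw [hI, Finset.image_eq_empty, Finset.Ico_eq_empty_iff] at h2
    omega
  · ext ⟨a, b⟩
    rw [mem_shape]
    rcases lt_or_ge b l with hb | hb
    · exact ⟨fun _ => Or.inl hb, fun _ => hlS b hb a⟩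
    · rw [hf b hb a]
      constructor
      · intro ha
        have hbN := (hpos b hb).1 (by omega)
        exact Or.inr ⟨hb, f b, Finset.mem_image_of_mem f (Finset.mem_Ico.2 ⟨hb, hbN⟩),
          hrank b hb hbN, ha⟩
      · rintro (h | ⟨_, n, hn, hr, ha⟩)
        · omega
        · obtain ⟨c, hc, rfl⟩ := Finset.mem_image.1 hn
          rw [Finset.mem_Ico] at hc
          rw [hrank c hc.1 hc.2] at hr
          have : c = b := by omega
          rwa [← this]

theorem zero_notMem_shape (l : ℕ) (I : Finset ℕ) : (0, l + I.card) ∉ shape l I := by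
  rintro (h | ⟨-, n, hn, hr, -⟩)
  · dsimp only at h
    omega
  · have := rankAbove_lt_card hn
    rw [rankAbove, hr] at this
    dsimp only at this
    omega

/-- The shape of `L_(0,I)` as a finite set. -/
def finShape (I : Finset ℕ) : Finset (ℕ × ℕ) :=
  (I.sigma fun n => Finset.range n).image fun x => (x.2, rankAbove I x.1)

theorem coe_finShape (I : Finset ℕ) : (finShape I : Set (ℕ × ℕ)) = shape 0 I := by
  ext ⟨a, b⟩
  rw [mem_shape]
  simp only [finShape, Finset.coe_image, Set.mem_image, Finset.mem_coe, Finset.mem_sigma,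
    Finset.mem_range, Prod.mk.injEq, Sigma.exists]
  constructor
  · rintro ⟨n, a, ⟨hn, ha⟩, rfl, rfl⟩
    exact Or.inr ⟨Nat.zero_le _, n, hn, rfl, ha⟩
  · rintro (h | ⟨-, n, hn, hr, ha⟩)
    · omega
    · exact ⟨n, a, ⟨hn, ha⟩, rfl, hr⟩

theorem card_finShape (I : Finset ℕ) : (finShape I).card = ∑ n ∈ I, n := by
  rw [finShape, Finset.card_image_of_injOn, Finset.card_sigma]
  · simp
  · rintro ⟨n, a⟩ hx ⟨m, b⟩ hy h
    simp only [Finset.coe_sigma, Set.mem_sigma_iff, Finset.mem_coe] at hx hy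
    obtain ⟨rfl, hr⟩ := Prod.mk.inj h
    obtain rfl := rankAbove_injOn I hx.1 hy.1 hr
    rfl

theorem finiteDimensional_Lsub'_iff (k : Type*) [Field k] (l : ℕ) (I : Finset ℕ) :
    FiniteDimensional k (Lsub' k l I) ↔ l = 0 := by
  rw [Lsub'_eq_supported]
  have e := Finsupp.supportedEquivFinsupp (M := k) (R := k) (shape l I \ {(0, 0)})
  rw [FiniteDimensional, Module.Finite.equiv_iff e, Module.finite_finsupp_self_iff,
    or_iff_right (not_subsingleton k), Set.finite_coe_iff]
  constructor
  · intro h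
    by_contra hl
    refine Set.infinite_range_of_injective (f := fun a : ℕ => (a + 1, 0)) ?_ (h.subset ?_)
    · intro a b hab
      simpa using hab
    · rintro _ ⟨a, rfl⟩
      exact ⟨Or.inl (Nat.pos_of_ne_zero hl), by simp⟩
  · rintro rfl
    rw [← coe_finShape]
    exact (Finset.finite_toSet _).subset Set.sdiff_subset

theorem finrank_Lsub'_zero (k : Type*) [Field k] {I : Finset ℕ} (h : (0, 0) ∈ shape 0 I) :
    Module.finrank k (Lsub' k 0 I) = (∑ n ∈ I, n) - 1 := by
  rw [Lsub'_eq_supported, ← coe_finShape, ← Finset.coe_singleton, ← Finset.coe_sdiff,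
    (Finsupp.supportedEquivFinsupp (M := k) (R := k)
      (↑(finShape I \ {(0, 0)}) : Set (ℕ × ℕ))).finrank_eq,
    Module.finrank_finsupp_self, ← card_finShape]
  rw [← coe_finShape, Finset.mem_coe] at h
  simp [h]

theorem Lsub'_ne_ker (k : Type*) [Field k] {l : ℕ} {I : Finset ℕ} (h : (l, I) ≠ (0, ∅)) :
    Lsub' k l I ≠ LinearMap.ker (ucou k) := by
  rw [Lsub'_eq_supported, ker_ucou]
  intro e
  have hmem : (0, l + I.card) ∈ {p : ℕ × ℕ | p ≠ (0, 0)} := by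
    intro e0
    have hs := (Prod.mk.inj e0).2
    refine h (Prod.ext ?_ (Finset.card_eq_zero.1 ?_)) <;> dsimp only <;> omega
  rw [← eq_of_supported_eq e] at hmem
  exact zero_notMem_shape l I hmem.1

theorem Lsub'_injective (k : Type*) [Field k] {l l' : ℕ} {I I' : Finset ℕ}
    (h0 : 0 ∉ I) (h : (l, I) ≠ (0, ∅)) (h0' : 0 ∉ I') (h' : (l', I') ≠ (0, ∅))
    (e : Lsub' k l I = Lsub' k l' I') : l = l' ∧ I = I' := by
  rw [Lsub'_eq_supported, Lsub'_eq_supported] at e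
  have hs := congrArg (insert (0, 0)) (eq_of_supported_eq e)
  rw [Set.insert_sdiff_singleton, Set.insert_sdiff_singleton,
    Set.insert_eq_of_mem (shape_isStaircase h0 h).zero_mem,
    Set.insert_eq_of_mem (shape_isStaircase h0' h').zero_mem] at hs
  exact shape_injective h0 h0' hs

theorem isCrossedEU_Lsub' (k : Type*) [Field k] {l : ℕ} {I : Finset ℕ} (h0 : 0 ∉ I)
    (h : (l, I) ≠ (0, ∅)) : IsCrossedEU k (Lsub' k l I) := by
  rw [Lsub'_eq_supported]
  exact (shape_isStaircase h0 h).isCrossedEU k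

theorem IsCrossedEU.exists_eq_Lsub' {k : Type*} [Field k] [CharZero k] {L : Submodule k (UU k)}
    (hL : IsCrossedEU k L) (hne : L ≠ LinearMap.ker (ucou k)) :
    ∃ l I, 0 ∉ I ∧ (l, I) ≠ (0, (∅ : Finset ℕ)) ∧ L = Lsub' k l I := by
  obtain ⟨S, hS, rfl⟩ := hL.exists_staircase
  have hSne : S ≠ Set.univ := by
    rintro rfl
    refine hne ?_
    rw [ker_ucou]
    congr 1
    ext p
    simp
  obtain ⟨l, I, h0, h, rfl⟩ := hS.exists_eq_shape hSne
  exact ⟨l, I, h0, h, (Lsub'_eq_supported k l I).symm⟩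


/-- corollary 3.4: the proper left crossed submodules of
`ker ε ⊂ U(b_+)` (left adjoint action, projected left regular coaction) are
exactly the `L'_(l,I) = L_(l,I) ∩ ker ε` for unique pairs `(l, I) ≠ (0, ∅)`;
`L'_(l,I)` is finite-dimensional iff `l = 0`, with
`dim L'_(0,I) = (∑_{n ∈ I} n) - 1`. -/
theorem classification_crossed_keru_UB (k : Type*) [Field k] [CharZero k] :
    (∀ L : Submodule k (UU k), L ≠ LinearMap.ker (ucou k) →
      (IsCrossedEU k L ↔
        ∃! lI : ℕ × Finset ℕ,
          0 ∉ lI.2 ∧ lI ≠ (0, (∅ : Finset ℕ)) ∧ L = Lsub' k lI.1 lI.2)) ∧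
    (∀ (l : ℕ) (I : Finset ℕ), 0 ∉ I → (l, I) ≠ (0, (∅ : Finset ℕ)) →
      IsCrossedEU k (Lsub' k l I) ∧ Lsub' k l I ≠ LinearMap.ker (ucou k) ∧
      (FiniteDimensional k (Lsub' k l I) ↔ l = 0) ∧
      (l = 0 → Module.finrank k (Lsub' k 0 I) = (∑ n ∈ I, n) - 1)) := by
  refine ⟨fun L hne => ⟨fun hL => ?_, ?_⟩, fun l I h0 h => ⟨isCrossedEU_Lsub' k h0 h,
    Lsub'_ne_ker k h, finiteDimensional_Lsub'_iff k l I, ?_⟩⟩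
  · obtain ⟨l, I, h0, h, e⟩ := hL.exists_eq_Lsub' hne
    refine ⟨(l, I), ⟨h0, h, e⟩, ?_⟩
    rintro ⟨l', I'⟩ ⟨h0', h', e'⟩
    obtain ⟨rfl, rfl⟩ := Lsub'_injective k h0 h h0' h' (e.symm.trans e')
    rfl
  · rintro ⟨⟨l, I⟩, ⟨h0, h, rfl⟩, -⟩
    exact isCrossedEU_Lsub' k h0 h
  · rintro rfl
    exact finrank_Lsub'_zero k (shape_isStaircase h0 h).zero_mem

end UBorel
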